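/- Let G be a graph and I an independent set of G such that for every vertex x of G, I △ {x} is also an independent set (i.e., I has degree n in I^0_AR(G)). For distinct vertices u, v of G, write I_u = I △ {u} and I_v = I △ {v}. Then u and v are non-adjacent in G if and only if there exists an independent set I' ≠ I with |I' △ I_u| = 1 and |I' △ I_v| = 1. -/

import Mathlib

/-- `s` is an independent set of `G`: no two of its vertices are adjacent. -/
def IndepFinset {V : Type*} (G : SimpleGraph V) (s : Finset V) : Prop :=
  ∀ u ∈ s, ∀ v ∈ s, ¬ G.Adj u v

/-- If toggling any single vertex keeps `I` independent, the vertices of `I` are isolated. -/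
theorem IndepFinset.not_adj_of_mem {V : Type*} [DecidableEq V] {G : SimpleGraph V}
    {I : Finset V} (hI : IndepFinset G I)
    (hdeg : ∀ x : V, IndepFinset G (symmDiff I {x})) {a : V} (ha : a ∈ I) (b : V) :
    ¬ G.Adj a b := by
  by_cases hb : b ∈ I
  · exact hI a ha b hb
  · have hab : a ≠ b := fun h => hb (h ▸ ha)
    exact hdeg b a (by simp [Finset.mem_symmDiff, ha, hab]) b
      (by simp [Finset.mem_symmDiff, hb])

theorem stmt15 {V : Type*} [DecidableEq V] (G : SimpleGraph V)
    (I : Finset V) (hI : IndepFinset G I)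
    (hdeg : ∀ x : V, IndepFinset G (symmDiff I {x}))
    (u v : V) (huv : u ≠ v) :
    ¬ G.Adj u v ↔
      ∃ I' : Finset V, IndepFinset G I' ∧ I' ≠ I ∧
        (symmDiff I' (symmDiff I {u})).card = 1 ∧
        (symmDiff I' (symmDiff I {v})).card = 1 := by
  constructor
  · intro h
    refine ⟨symmDiff (symmDiff I {u}) {v}, ?_, ?_, ?_, ?_⟩
    · have key : ∀ a ∈ symmDiff (symmDiff I {u}) {v}, a ∈ I ∨ a = u ∨ a = v := by
        intro a ha
        simp only [Finset.mem_symmDiff, Finset.mem_singleton] at ha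
        tauto
      intro a ha b hb hab
      rcases key a ha with haI | ha
      · exact hI.not_adj_of_mem hdeg haI b hab
      rcases key b hb with hbI | hb
      · exact hI.not_adj_of_mem hdeg hbI a hab.symm
      rcases ha with rfl | rfl <;> rcases hb with rfl | rfl
      · exact G.irrefl hab
      · exact h hab
      · exact h hab.symm
      · exact G.irrefl hab
    · intro h'
      rw [symmDiff_assoc, symmDiff_eq_left, symmDiff_eq_bot, Finset.singleton_inj] at h'
      exact huv h'
    · rw [symmDiff_comm, symmDiff_symmDiff_cancel_left, Finset.card_singleton]
    · rw [symmDiff_right_comm I {u} {v}, symmDiff_comm, symmDiff_symmDiff_cancel_left,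
        Finset.card_singleton]
  · rintro ⟨I', hI', hne, hu, hv⟩ hadj
    have huI : u ∉ I := fun h => hI.not_adj_of_mem hdeg h v hadj
    have hvI : v ∉ I := fun h => hI.not_adj_of_mem hdeg h u hadj.symm
    obtain ⟨a, ha⟩ := Finset.card_eq_one.mp hu
    obtain ⟨b, hb⟩ := Finset.card_eq_one.mp hv
    have ha' : I' = symmDiff {a} (symmDiff I {u}) := by
      rw [← ha, symmDiff_symmDiff_cancel_right]
    have hb' : I' = symmDiff {b} (symmDiff I {v}) := by
      rw [← hb, symmDiff_symmDiff_cancel_right]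
    have hau : a ≠ u := by
      rintro rfl
      exact hne (by rw [ha', symmDiff_comm, symmDiff_symmDiff_cancel_right])
    have hbv : b ≠ v := by
      rintro rfl
      exact hne (by rw [hb', symmDiff_comm, symmDiff_symmDiff_cancel_right])
    have hu' : u ∈ I' := by
      rw [ha']
      simp [Finset.mem_symmDiff, huI, hau.symm]
    have hv' : v ∈ I' := by
      rw [hb']
      simp [Finset.mem_symmDiff, hvI, hbv.symm]
    exact hI' u hu' v hv' hadj
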